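/- There exist universal constants c₁ > 0 and c₂ > 0 such that the following holds. For every near-separable instance M̃ = WH + N as in the assumption with m = r, if ε ≤ c₁ · σ_min(W)/(r √r), A* is an optimal solution of the minimum-volume-ellipsoid SDP associated with M̃, and Q ∈ ℝ^{r×r} satisfies QᵀQ = A*, then the index set K produced by SPA applied to QM̃ with parameter r satisfies max_{1≤j≤r} min_{k∈K} ‖W(:,j) − M̃(:,k)‖₂ ≤ c₂ · ε · κ(W). -/

import Mathlib

open Matrix BigOperators

/-- Euclidean norm of a vector in `ℝ^m`. -/
noncomputable def colNorm {m : ℕ} (v : Fin m → ℝ) : ℝ := Real.sqrt (∑ i, (v i) ^ 2)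

/-- Largest singular value of a matrix. -/
noncomputable def sigmaMax {m n : ℕ} (X : Matrix (Fin m) (Fin n) ℝ) : ℝ :=
  sSup {c : ℝ | ∃ v : Fin n → ℝ, colNorm v = 1 ∧ c = colNorm (X.mulVec v)}

/-- Smallest singular value of a matrix. -/
noncomputable def sigmaMin {m n : ℕ} (X : Matrix (Fin m) (Fin n) ℝ) : ℝ :=
  sInf {c : ℝ | ∃ v : Fin n → ℝ, colNorm v = 1 ∧ c = colNorm (X.mulVec v)}

/-- Condition number `κ(X) = σ_max(X) / σ_min(X)`. -/
noncomputable def kappa {m n : ℕ} (X : Matrix (Fin m) (Fin n) ℝ) : ℝ :=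
  sigmaMax X / sigmaMin X

/-- Largest eigenvalue of a symmetric matrix, via the Rayleigh quotient. -/
noncomputable def lamMax {r : ℕ} (C : Matrix (Fin r) (Fin r) ℝ) : ℝ :=
  sSup {c : ℝ | ∃ v : Fin r → ℝ, colNorm v = 1 ∧ c = v ⬝ᵥ C.mulVec v}

/-- Smallest eigenvalue of a symmetric matrix, via the Rayleigh quotient. -/
noncomputable def lamMin {r : ℕ} (C : Matrix (Fin r) (Fin r) ℝ) : ℝ :=
  sInf {c : ℝ | ∃ v : Fin r → ℝ, colNorm v = 1 ∧ c = v ⬝ᵥ C.mulVec v}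

/-- Near-separable assumption with `m = r`: `Mt = W * H + N` where `W ∈ ℝ^{r×r}` is
invertible, `H = [I_r, H']` is nonnegative with column sums at most one and whose first `r`
columns form the identity matrix, and each column of `N` has Euclidean norm at most `ε`. -/
def NearSepSquare (r n : ℕ) (W : Matrix (Fin r) (Fin r) ℝ) (H : Matrix (Fin r) (Fin n) ℝ)
    (N Mt : Matrix (Fin r) (Fin n) ℝ) (ε : ℝ) : Prop :=
  IsUnit W.det ∧ Mt = W * H + N ∧ (∀ i j, 0 ≤ H i j) ∧ (∀ j, ∑ i, H i j ≤ 1) ∧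
    (∃ h : r ≤ n, ∀ i j : Fin r, H i (Fin.castLE h j) = if i = j then 1 else 0) ∧
    0 ≤ ε ∧ ∀ j, colNorm (fun i => N i j) ≤ ε

/-- `A` is feasible for the minimum-volume-ellipsoid SDP associated with `Mt`:
`A` is positive semidefinite and `m̃ᵢᵀ A m̃ᵢ ≤ 1` for every column `m̃ᵢ` of `Mt`. -/
def SDPFeasible {r n : ℕ} (Mt : Matrix (Fin r) (Fin n) ℝ)
    (A : Matrix (Fin r) (Fin r) ℝ) : Prop :=
  A.PosSemidef ∧ ∀ j : Fin n, (fun i => Mt i j) ⬝ᵥ A.mulVec (fun i => Mt i j) ≤ 1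

/-- `A` is an optimal solution of the minimum-volume-ellipsoid SDP associated with `Mt`:
it is feasible and maximizes the determinant among the feasible matrices. -/
def SDPOptimal {r n : ℕ} (Mt : Matrix (Fin r) (Fin n) ℝ)
    (A : Matrix (Fin r) (Fin r) ℝ) : Prop :=
  SDPFeasible Mt A ∧ ∀ B : Matrix (Fin r) (Fin r) ℝ, SDPFeasible Mt B → B.det ≤ A.det

/-- Projection of the columns of `X` onto the orthogonal complement of `u`:
`X ← (I − uuᵀ/‖u‖²) X`. -/
noncomputable def projOut {m n : ℕ} (u : Fin m → ℝ) (X : Matrix (Fin m) (Fin n) ℝ) :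
    Matrix (Fin m) (Fin n) ℝ :=
  fun i j => X i j - ((∑ l, u l * X l j) / (∑ l, u l * u l)) * u i

/-- `IsSPA X r K` holds iff `K` is a possible output of the successive projection algorithm
applied to `X` with `r` steps (for some tie-breaking choices in the argmax steps). -/
inductive IsSPA {m n : ℕ} : Matrix (Fin m) (Fin n) ℝ → ℕ → Finset (Fin n) → Prop
  | nil (X : Matrix (Fin m) (Fin n) ℝ) : IsSPA X 0 ∅
  | step (X : Matrix (Fin m) (Fin n) ℝ) (r : ℕ) (k : Fin n) (K : Finset (Fin n)) :
      (∀ j : Fin n, colNorm (fun i => X i j) ≤ colNorm (fun i => X i k)) →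
      IsSPA (projOut (fun i => X i k) X) r K →
      IsSPA X (r + 1) (insert k K)

theorem colNorm_eq_norm {m : ℕ} (v : Fin m → ℝ) : colNorm v = ‖WithLp.toLp 2 v‖ := by
  simp [colNorm, EuclideanSpace.norm_eq]

theorem sigmaMin_mul_norm_le {m n : ℕ} (X : Matrix (Fin m) (Fin n) ℝ)
    (v : EuclideanSpace ℝ (Fin n)) : sigmaMin X * ‖v‖ ≤ ‖X.toEuclideanLin v‖ := by
  rcases eq_or_ne v 0 with rfl | hv
  · simp
  have hv' : 0 < ‖v‖ := norm_pos_iff.2 hv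
  rw [← le_div_iff₀ hv']
  refine csInf_le ⟨0, ?_⟩ ⟨WithLp.ofLp (‖v‖⁻¹ • v), ?_, ?_⟩
  · rintro c ⟨v, -, rfl⟩
    exact Real.sqrt_nonneg _
  · rw [colNorm_eq_norm, WithLp.toLp_ofLp, norm_smul, norm_inv, norm_norm,
      inv_mul_cancel₀ hv'.ne']
  · rw [colNorm_eq_norm, ← Matrix.toLpLin_apply, map_smul, norm_smul, norm_inv, norm_norm]
    field_simp

theorem norm_le_sigmaMax_mul {m n : ℕ} (X : Matrix (Fin m) (Fin n) ℝ)
    (v : EuclideanSpace ℝ (Fin n)) : ‖X.toEuclideanLin v‖ ≤ sigmaMax X * ‖v‖ := by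
  rcases eq_or_ne v 0 with rfl | hv
  · simp
  have hv' : 0 < ‖v‖ := norm_pos_iff.2 hv
  rw [← div_le_iff₀ hv']
  refine le_csSup ⟨‖LinearMap.toContinuousLinearMap X.toEuclideanLin‖, ?_⟩
    ⟨WithLp.ofLp (‖v‖⁻¹ • v), ?_, ?_⟩
  · rintro c ⟨v, hv, rfl⟩
    have := (LinearMap.toContinuousLinearMap X.toEuclideanLin).le_opNorm (WithLp.toLp 2 v)
    rw [colNorm_eq_norm] at hv ⊢
    rw [hv, mul_one] at this
    exact this
  · rw [colNorm_eq_norm, WithLp.toLp_ofLp, norm_smul, norm_inv, norm_norm,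
      inv_mul_cancel₀ hv'.ne']
  · rw [colNorm_eq_norm, ← Matrix.toLpLin_apply, map_smul, norm_smul, norm_inv, norm_norm]
    field_simp

theorem toEuclideanLin_mul_apply {l m n : ℕ} (X : Matrix (Fin l) (Fin m) ℝ)
    (Y : Matrix (Fin m) (Fin n) ℝ) (v : EuclideanSpace ℝ (Fin n)) :
    (X * Y).toEuclideanLin v = X.toEuclideanLin (Y.toEuclideanLin v) := by
  simp

theorem sigmaMin_pos {r : ℕ} (hr : 0 < r) (X : Matrix (Fin r) (Fin r) ℝ) (hX : IsUnit X.det) :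
    0 < sigmaMin X := by
  set L := LinearMap.toContinuousLinearMap (X⁻¹).toEuclideanLin with hL
  have key : ∀ v : EuclideanSpace ℝ (Fin r), ‖v‖ ≤ ‖L‖ * ‖X.toEuclideanLin v‖ := by
    intro v
    have h := L.le_opNorm (X.toEuclideanLin v)
    have h2 : L (X.toEuclideanLin v) = v := by
      change (X⁻¹).toEuclideanLin (X.toEuclideanLin v) = v
      rw [← toEuclideanLin_mul_apply, Matrix.nonsing_inv_mul _ hX]
      simp
    rwa [h2] at h
  have he : colNorm (Pi.single (⟨0, hr⟩ : Fin r) (1 : ℝ)) = 1 := by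
    rw [colNorm_eq_norm]; simp
  have hLpos : 0 < ‖L‖ := by
    by_contra hneg
    have h := key (WithLp.toLp 2 (Pi.single (⟨0, hr⟩ : Fin r) (1 : ℝ)))
    rw [← colNorm_eq_norm, he] at h
    have : ‖L‖ = 0 := le_antisymm (not_lt.1 hneg) (norm_nonneg _)
    rw [this, zero_mul] at h
    linarith
  refine lt_of_lt_of_le (inv_pos.2 hLpos) (le_csInf ⟨_, _, he, rfl⟩ ?_)
  rintro c ⟨v, hv, rfl⟩
  have h := key (WithLp.toLp 2 v)
  rw [← colNorm_eq_norm, hv] at h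
  rw [inv_le_iff_one_le_mul₀' hLpos, colNorm_eq_norm]
  exact h

section Gram

variable {r : ℕ} (Y : Matrix (Fin r) (Fin r) ℝ)

theorem inner_gram_apply (u v : EuclideanSpace ℝ (Fin r)) :
    inner ℝ u ((Yᵀ * Y).toEuclideanLin v) =
      inner ℝ (Y.toEuclideanLin u) (Y.toEuclideanLin v) := by
  rw [toEuclideanLin_mul_apply, ← Matrix.conjTranspose_eq_transpose_of_trivial,
    Matrix.toEuclideanLin_conjTranspose_eq_adjoint, LinearMap.adjoint_inner_right]

theorem isHermitian_gram : (Yᵀ * Y).IsHermitian := by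
  simpa using Matrix.isHermitian_conjTranspose_mul_self Y

theorem gram_apply_eigenvectorBasis (i : Fin r) :
    (Yᵀ * Y).toEuclideanLin ((isHermitian_gram Y).eigenvectorBasis i) =
      (isHermitian_gram Y).eigenvalues i • (isHermitian_gram Y).eigenvectorBasis i := by
  rw [Matrix.toLpLin_apply, (isHermitian_gram Y).mulVec_eigenvectorBasis]
  simp

theorem gram_eigenvalue_eq_norm_sq (i : Fin r) :
    (isHermitian_gram Y).eigenvalues i =
      ‖Y.toEuclideanLin ((isHermitian_gram Y).eigenvectorBasis i)‖ ^ 2 := by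
  rw [← real_inner_self_eq_norm_sq, ← inner_gram_apply, gram_apply_eigenvectorBasis,
    inner_smul_right, real_inner_self_eq_norm_sq, OrthonormalBasis.norm_eq_one]
  simp

theorem norm_sq_eq_sum_gram_eigenvalues (v : EuclideanSpace ℝ (Fin r)) :
    ‖Y.toEuclideanLin v‖ ^ 2 = ∑ i, (isHermitian_gram Y).eigenvalues i *
      (inner ℝ ((isHermitian_gram Y).eigenvectorBasis i) v) ^ 2 := by
  rw [← real_inner_self_eq_norm_sq, ← inner_gram_apply,
    ← OrthonormalBasis.sum_inner_mul_inner (isHermitian_gram Y).eigenvectorBasis]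
  refine Finset.sum_congr rfl fun i _ => ?_
  rw [inner_gram_apply, real_inner_comm (Y.toEuclideanLin v), ← inner_gram_apply,
    gram_apply_eigenvectorBasis, inner_smul_right, real_inner_comm v]
  ring

theorem prod_gram_eigenvalues : ∏ i, (isHermitian_gram Y).eigenvalues i = Y.det ^ 2 := by
  have := (isHermitian_gram Y).det_eq_prod_eigenvalues
  rw [Matrix.det_mul, Matrix.det_transpose] at this
  simpa [sq] using this.symm

theorem sum_gram_eigenvalues :
    ∑ i, (isHermitian_gram Y).eigenvalues i = ∑ j, colNorm (fun i => Y i j) ^ 2 := by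
  have := (isHermitian_gram Y).trace_eq_sum_eigenvalues
  simp only [RCLike.ofReal_real_eq_id, id] at this
  rw [← this, Matrix.trace]
  refine Finset.sum_congr rfl fun j _ => ?_
  rw [colNorm, Real.sq_sqrt (Finset.sum_nonneg fun i _ => sq_nonneg _)]
  simp [Matrix.mul_apply, sq]

theorem pow_le_det_sq {a : ℝ} (ha : 0 ≤ a)
    (h : ∀ v : EuclideanSpace ℝ (Fin r), a * ‖v‖ ≤ ‖Y.toEuclideanLin v‖) :
    a ^ (2 * r) ≤ Y.det ^ 2 := by
  rw [← prod_gram_eigenvalues, pow_mul]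
  have : ∏ _i : Fin r, a ^ 2 = (a ^ 2) ^ r := by simp
  rw [← this]
  refine Finset.prod_le_prod (fun _ _ => sq_nonneg _) fun i _ => ?_
  rw [gram_eigenvalue_eq_norm_sq]
  have := h ((isHermitian_gram Y).eigenvectorBasis i)
  rw [OrthonormalBasis.norm_eq_one, mul_one] at this
  gcongr

/-- A matrix whose columns lie in the unit ball and whose determinant is nearly extremal in
Hadamard's inequality is nearly orthogonal. -/
theorem near_isometry_of_det (hcol : ∀ j, colNorm (fun i => Y i j) ≤ 1)
    (hdet : 1 - 1 / 20000 ≤ Y.det ^ 2) (v : EuclideanSpace ℝ (Fin r)) :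
    99 / 100 * ‖v‖ ≤ ‖Y.toEuclideanLin v‖ ∧ ‖Y.toEuclideanLin v‖ ≤ 101 / 100 * ‖v‖ := by
  set l := (isHermitian_gram Y).eigenvalues with hl
  have hnn : ∀ i, 0 ≤ l i := fun i => by
    rw [hl, gram_eigenvalue_eq_norm_sq]; positivity
  have hprod : ∏ i, l i = Y.det ^ 2 := prod_gram_eigenvalues Y
  have hpos : ∀ i, 0 < l i := fun i => by
    refine lt_of_le_of_ne (hnn i) fun h0 => ?_
    rw [Finset.prod_eq_zero (Finset.mem_univ i) h0.symm] at hprod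
    linarith
  have hsum : ∑ i, l i ≤ r := by
    rw [hl, sum_gram_eigenvalues]
    calc _ ≤ ∑ _j : Fin r, (1 : ℝ) := Finset.sum_le_sum fun j _ =>
          pow_le_one₀ (Real.sqrt_nonneg _) (hcol j)
      _ = r := by simp
  have hlog : -(1 / 10000) ≤ ∑ i, Real.log (l i) := by
    rw [← Real.log_prod (fun i _ => (hpos i).ne'), hprod]
    refine le_trans ?_ (Real.log_le_log (by norm_num) hdet)
    refine le_trans ?_ (Real.one_sub_inv_le_log_of_pos (by norm_num))
    norm_num
  have hterm : ∀ i, (√(l i) - 1) ^ 2 ≤ l i - 1 - Real.log (l i) := fun i => by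
    have h1 := Real.log_le_sub_one_of_pos (Real.sqrt_pos.2 (hpos i))
    rw [Real.log_sqrt (hnn i)] at h1
    have h2 := Real.sq_sqrt (hnn i)
    nlinarith
  have hbd : ∀ i, (√(l i) - 1) ^ 2 ≤ 1 / 10000 := fun i => by
    have h1 : l i - 1 - Real.log (l i) ≤ ∑ i, (l i - 1 - Real.log (l i)) :=
      Finset.single_le_sum (f := fun i => l i - 1 - Real.log (l i))
        (fun i _ => (sq_nonneg _).trans (hterm i)) (Finset.mem_univ i)
    have h2 : ∑ i, (l i - 1 - Real.log (l i)) = ∑ i, l i - r - ∑ i, Real.log (l i) := by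
      simp [Finset.sum_sub_distrib]
    linarith [hterm i]
  have hrange : ∀ i, (99 / 100) ^ 2 ≤ l i ∧ l i ≤ (101 / 100) ^ 2 := fun i => by
    have h1 := abs_le_of_sq_le_sq' (show (√(l i) - 1) ^ 2 ≤ (1 / 100) ^ 2 by
      linarith [hbd i]) (by norm_num)
    have h2 := Real.sq_sqrt (hnn i)
    constructor <;> nlinarith [h1.1, h1.2]
  have hv : ‖v‖ ^ 2 = ∑ i, (inner ℝ ((isHermitian_gram Y).eigenvectorBasis i) v) ^ 2 := by
    rw [← OrthonormalBasis.sum_sq_norm_inner_right (isHermitian_gram Y).eigenvectorBasis]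
    simp
  have hYv := norm_sq_eq_sum_gram_eigenvalues Y v
  constructor
  · refine le_of_sq_le_sq ?_ (norm_nonneg _)
    rw [mul_pow, hv, hYv, Finset.mul_sum]
    gcongr with i
    exact (hrange i).1
  · refine le_of_sq_le_sq ?_ (by positivity)
    rw [mul_pow, hv, hYv, Finset.mul_sum]
    gcongr with i
    exact (hrange i).2

end Gram

section SPA

variable {E : Type*} [NormedAddCommGroup E] [InnerProductSpace ℝ E]

theorem norm_sum_smul_sq_le {ι : Type*} [DecidableEq ι] (S : Finset ι) (h : ι → ℝ) (p : ι → E)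
    {μ : ℝ} (hh : ∀ i ∈ S, 0 ≤ h i) (hp : ∀ i ∈ S, ‖p i‖ ≤ μ)
    (hsep : ∀ i ∈ S, ∀ j ∈ S, i ≠ j → 9 / 5 ≤ ‖p i - p j‖ ^ 2) :
    ‖∑ i ∈ S, h i • p i‖ ^ 2 ≤
      (μ ^ 2 - 9 / 10) * (∑ i ∈ S, h i) ^ 2 + 9 / 10 * ∑ i ∈ S, h i ^ 2 := by
  have key : ∀ i ∈ S, ∀ j ∈ S, h i * (h j * inner ℝ (p i) (p j)) ≤
      (μ ^ 2 - 9 / 10) * (h i * h j) + if i = j then 9 / 10 * h i ^ 2 else 0 := by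
    intro i hi j hj
    have hij := mul_nonneg (hh i hi) (hh j hj)
    have h1 : ‖p i‖ ^ 2 ≤ μ ^ 2 := pow_le_pow_left₀ (norm_nonneg _) (hp i hi) 2
    have h2 : ‖p j‖ ^ 2 ≤ μ ^ 2 := pow_le_pow_left₀ (norm_nonneg _) (hp j hj) 2
    split_ifs with he
    · subst he
      rw [real_inner_self_eq_norm_sq]
      nlinarith
    · have h3 := hsep i hi j hj he
      rw [norm_sub_sq_real] at h3
      nlinarith
  calc ‖∑ i ∈ S, h i • p i‖ ^ 2
      = ∑ i ∈ S, ∑ j ∈ S, h i * (h j * inner ℝ (p i) (p j)) := by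
        rw [← real_inner_self_eq_norm_sq, sum_inner]
        refine Finset.sum_congr rfl fun i _ => ?_
        rw [inner_sum]
        refine Finset.sum_congr rfl fun j _ => ?_
        rw [real_inner_smul_left, real_inner_smul_right]
    _ ≤ ∑ i ∈ S, ∑ j ∈ S, ((μ ^ 2 - 9 / 10) * (h i * h j) +
          if i = j then 9 / 10 * h i ^ 2 else 0) :=
        Finset.sum_le_sum fun i hi => Finset.sum_le_sum fun j hj => key i hi j hj
    _ = _ := by
        rw [sq (∑ i ∈ S, h i), Finset.sum_mul_sum, Finset.mul_sum, Finset.mul_sum,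
          ← Finset.sum_add_distrib]
        refine Finset.sum_congr rfl fun i hi => ?_
        rw [Finset.sum_add_distrib, ← Finset.mul_sum, Finset.sum_ite_eq, if_pos hi]

/-- One extraction step: a point whose projection is nearly as long as those of all the vertices
outside `T` is close to one of these vertices. -/
theorem exists_near_vertex {ι : Type*} [Fintype ι] [DecidableEq ι] (w : ι → E) (T : Finset ι)
    (hT : Tᶜ.Nonempty) (P : E →ₗ[ℝ] E) (hP : ∀ v, ‖P v‖ ≤ ‖v‖)
    (hw : ∀ i, ‖w i‖ ≤ 21 / 20) (hTP : ∀ i ∈ T, ‖P (w i)‖ ≤ 1 / 10)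
    (hlow : ∀ i ∉ T, 97 / 100 ≤ ‖P (w i)‖)
    (hsep : ∀ i ∉ T, ∀ j ∉ T, i ≠ j → 9 / 5 ≤ ‖P (w i) - P (w j)‖ ^ 2)
    (h : ι → ℝ) (hh : ∀ i, 0 ≤ h i) (hsum : ∑ i, h i ≤ 1) {e : ℝ} (he : e ≤ 1 / 100)
    (x : E) (hx : ‖x - ∑ i, h i • w i‖ ≤ e) (hmax : ∀ i ∉ T, ‖P (w i)‖ - e ≤ ‖P x‖) :
    ∃ i ∉ T, ‖w i - x‖ ≤ 25 * e := by
  have he0 : 0 ≤ e := (norm_nonneg _).trans hx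
  obtain ⟨i₀, hi₀, hi₀max⟩ := Finset.exists_max_image Tᶜ (fun i => ‖P (w i)‖) hT
  obtain ⟨i₁, hi₁, hi₁max⟩ := Finset.exists_max_image Tᶜ h hT
  set μ := ‖P (w i₀)‖ with hμ
  set s := ∑ i ∈ Tᶜ, h i with hs
  set t := ∑ i ∈ T, h i with ht
  have hst : s + t ≤ 1 := by
    rw [hs, ht, add_comm, Finset.sum_add_sum_compl]; exact hsum
  have ht0 : 0 ≤ t := Finset.sum_nonneg fun i _ => hh i
  have hs0 : 0 ≤ s := Finset.sum_nonneg fun i _ => hh i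
  have hμl : 97 / 100 ≤ μ := hlow i₀ (by simpa using hi₀)
  have hμu : μ ≤ 21 / 20 := (hP _).trans (hw _)
  set y := ∑ i ∈ Tᶜ, h i • P (w i) with hy
  have hyl : μ - 2 * e - t / 10 ≤ ‖y‖ := by
    have h1 := hmax i₀ (by simpa using hi₀)
    have h2 : P x = P (x - ∑ i, h i • w i) + (∑ i ∈ T, h i • P (w i) + y) := by
      rw [hy, Finset.sum_add_sum_compl, map_sub, map_sum]
      simp
    have h3 : ‖∑ i ∈ T, h i • P (w i)‖ ≤ t / 10 := by
      refine (norm_sum_le _ _).trans ?_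
      rw [ht, Finset.sum_div]
      refine Finset.sum_le_sum fun i hi => ?_
      rw [norm_smul, Real.norm_of_nonneg (hh i)]
      nlinarith [hh i, hTP i hi]
    have h4 : ‖P x‖ ≤ e + (t / 10 + ‖y‖) := by
      rw [h2]
      refine (norm_add_le _ _).trans (add_le_add ((hP _).trans hx) ?_)
      exact (norm_add_le _ _).trans (add_le_add h3 le_rfl)
    linarith
  have hyu : ‖y‖ ≤ μ * s := by
    refine (norm_sum_le _ _).trans ?_
    rw [hs, Finset.mul_sum]
    refine Finset.sum_le_sum fun i hi => ?_
    rw [norm_smul, Real.norm_of_nonneg (hh i), mul_comm]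
    exact mul_le_mul_of_nonneg_right (hi₀max i hi) (hh i)
  have hysq : ‖y‖ ^ 2 ≤ (μ ^ 2 - 9 / 10) * s ^ 2 + 9 / 10 * (h i₁ * s) := by
    refine (norm_sum_smul_sq_le Tᶜ h (fun i => P (w i)) (fun i _ => hh i) hi₀max ?_).trans ?_
    · intro i hi j hj hij
      exact hsep i (by simpa using hi) j (by simpa using hj) hij
    · gcongr
      rw [hs, Finset.mul_sum]
      refine Finset.sum_le_sum fun i hi => ?_
      rw [sq]
      exact mul_le_mul_of_nonneg_right (hi₁max i hi) (hh i)
  have ht1 : t ≤ 3 * e := by nlinarith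
  have hyl' : μ - 23 / 10 * e ≤ ‖y‖ := by linarith
  have hs1 : 1 - s ≤ 3 * e := by nlinarith
  have hs2 : s ≤ 1 := by linarith
  have hgap : s - h i₁ ≤ 7 * e := by
    have h1 : (μ - 23 / 10 * e) ^ 2 ≤ ‖y‖ ^ 2 := pow_le_pow_left₀ (by linarith) hyl' 2
    have h2 : 9 / 10 * (s * (s - h i₁)) ≤ 5 * e := by
      have h3 : μ ^ 2 * s ^ 2 ≤ μ ^ 2 :=
        mul_le_of_le_one_right (sq_nonneg _) (pow_le_one₀ hs0 hs2)
      have h4 : μ * e ≤ 21 / 20 * e := mul_le_mul_of_nonneg_right hμu he0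
      linarith [sq_nonneg e]
    by_contra hcon
    push Not at hcon
    nlinarith
  have hi₁T : i₁ ∉ T := by simpa using hi₁
  refine ⟨i₁, hi₁T, ?_⟩
  have hrest : ∑ i ∈ Finset.univ.erase i₁, h i ≤ 1 - h i₁ := by
    have := Finset.add_sum_erase Finset.univ h (Finset.mem_univ i₁)
    linarith
  have hrest' : ‖∑ i ∈ Finset.univ.erase i₁, h i • w i‖ ≤ 21 / 20 * (1 - h i₁) := by
    refine (norm_sum_le _ _).trans (le_trans ?_ (mul_le_mul_of_nonneg_left hrest (by norm_num)))
    rw [Finset.mul_sum]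
    refine Finset.sum_le_sum fun i _ => ?_
    rw [norm_smul, Real.norm_of_nonneg (hh i), mul_comm]
    exact mul_le_mul_of_nonneg_right (hw i) (hh i)
  have hle : 0 ≤ 1 - h i₁ := (Finset.sum_nonneg fun i _ => hh i).trans hrest
  have hself : ‖(1 - h i₁) • w i₁‖ ≤ 21 / 20 * (1 - h i₁) := by
    rw [norm_smul, Real.norm_of_nonneg hle, mul_comm]
    exact mul_le_mul_of_nonneg_right (hw i₁) hle
  have hdecomp : w i₁ - x = (1 - h i₁) • w i₁ - ∑ i ∈ Finset.univ.erase i₁, h i • w i -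
      (x - ∑ i, h i • w i) := by
    rw [← Finset.add_sum_erase Finset.univ (fun i => h i • w i) (Finset.mem_univ i₁)]
    module
  rw [hdecomp]
  refine (norm_sub_le _ _).trans ?_
  have := norm_sub_le ((1 - h i₁) • w i₁) (∑ i ∈ Finset.univ.erase i₁, h i • w i)
  linarith

theorem norm_sum_smul_le_sqrt_mul {r : ℕ} (a : EuclideanSpace ℝ (Fin r)) (z : Fin r → E) {d : ℝ}
    (hd : 0 ≤ d) (hz : ∀ i, a i ≠ 0 → ‖z i‖ ≤ d) : ‖∑ i, a i • z i‖ ≤ √r * d * ‖a‖ := by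
  calc ‖∑ i, a i • z i‖ ≤ ∑ i, ‖a i‖ * d := by
        refine (norm_sum_le _ _).trans (Finset.sum_le_sum fun i _ => ?_)
        rw [norm_smul]
        by_cases hi : a i = 0
        · simp [hi]
        · exact mul_le_mul_of_nonneg_left (hz i hi) (norm_nonneg _)
    _ = (∑ i, ‖a i‖) * d := by rw [Finset.sum_mul]
    _ ≤ (√r * ‖a‖) * d := by
        gcongr
        rw [EuclideanSpace.norm_eq, ← Real.sqrt_mul (by positivity)]
        refine Real.le_sqrt_of_sq_le ?_
        have := sq_sum_le_card_mul_sum_sq (s := Finset.univ) (f := fun i => ‖a i‖)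
        simpa using this
    _ = √r * d * ‖a‖ := by ring

/-- After the vertices in `T` have been extracted, projecting along the extracted points keeps
the span of the remaining vertices well conditioned. -/
theorem norm_proj_comb_ge {r : ℕ} (w z : Fin r → E)
    (hw : ∀ c : EuclideanSpace ℝ (Fin r), 98 / 100 * ‖c‖ ≤ ‖∑ i, c i • w i‖)
    (T : Finset (Fin r)) {d : ℝ} (hd0 : 0 ≤ d) (hd : √r * d ≤ 1 / 100)
    (hz : ∀ i ∈ T, ‖w i - z i‖ ≤ d)
    (c a : EuclideanSpace ℝ (Fin r)) (hc : ∀ i ∈ T, c i = 0) (ha : ∀ i ∉ T, a i = 0) :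
    97 / 100 * ‖c‖ ≤ ‖∑ i, c i • w i - ∑ i, a i • z i‖ := by
  have hnorm : ‖c - a‖ ^ 2 = ‖c‖ ^ 2 + ‖a‖ ^ 2 := by
    rw [EuclideanSpace.norm_sq_eq, EuclideanSpace.norm_sq_eq, EuclideanSpace.norm_sq_eq,
      ← Finset.sum_add_distrib]
    refine Finset.sum_congr rfl fun i _ => ?_
    by_cases hi : i ∈ T
    · simp [hc i hi]
    · simp [ha i hi]
  have h1 : ‖c‖ ≤ ‖c - a‖ := le_of_sq_le_sq (by nlinarith [sq_nonneg ‖a‖]) (norm_nonneg _)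
  have h2 : ‖a‖ ≤ ‖c - a‖ := le_of_sq_le_sq (by nlinarith [sq_nonneg ‖c‖]) (norm_nonneg _)
  have h3 : ‖∑ i, a i • (w i - z i)‖ ≤ 1 / 100 * ‖a‖ := by
    refine (norm_sum_smul_le_sqrt_mul a (fun i => w i - z i) hd0 fun i hi => hz i ?_).trans
      (mul_le_mul_of_nonneg_right hd (norm_nonneg _))
    exact not_imp_comm.1 (ha i) hi
  have h4 : ∑ i, c i • w i - ∑ i, a i • z i =
      ∑ i, (c - a) i • w i + ∑ i, a i • (w i - z i) := by
    rw [← Finset.sum_sub_distrib, ← Finset.sum_add_distrib]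
    refine Finset.sum_congr rfl fun i _ => ?_
    rw [PiLp.sub_apply]
    module
  rw [h4]
  have h5 := norm_sub_le (∑ i, (c - a) i • w i + ∑ i, a i • (w i - z i))
    (∑ i, a i • (w i - z i))
  rw [add_sub_cancel_right] at h5
  linarith [hw (c - a), norm_nonneg a]

theorem norm_sub_inner_div_smul_le (u v : E) :
    ‖v - (inner ℝ u v / inner ℝ u u) • u‖ ≤ ‖v‖ := by
  rcases eq_or_ne u 0 with rfl | hu
  · simp
  have hu' : 0 < ‖u‖ ^ 2 := by positivity
  refine le_of_sq_le_sq ?_ (norm_nonneg _)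
  rw [norm_sub_sq_real, real_inner_smul_right, norm_smul, mul_pow, real_inner_self_eq_norm_sq,
    real_inner_comm u v, Real.norm_eq_abs, sq_abs]
  have : (inner ℝ u v / ‖u‖ ^ 2) ^ 2 * ‖u‖ ^ 2 =
      inner ℝ u v / ‖u‖ ^ 2 * inner ℝ u v := by field_simp
  rw [this]
  have : 0 ≤ inner ℝ u v / ‖u‖ ^ 2 * inner ℝ u v := by
    rw [div_mul_eq_mul_div]
    exact div_nonneg (mul_self_nonneg _) hu'.le
  linarith

/-- The linear map removing from `P v` its component along `u`. -/
noncomputable def deflate (P : E →ₗ[ℝ] E) (u : E) : E →ₗ[ℝ] E :=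
  P - ((inner ℝ u u)⁻¹ • ((innerSL ℝ u : E →L[ℝ] ℝ) : E →ₗ[ℝ] ℝ) ∘ₗ P).smulRight u

theorem deflate_apply (P : E →ₗ[ℝ] E) (u v : E) :
    deflate P u v = P v - (inner ℝ u (P v) / inner ℝ u u) • u := by
  simp [deflate, div_eq_inv_mul]

end SPA

/-- Robustness of SPA when the vertices `w` are nearly orthonormal. The points extracted so far
are `x (f i)` for `i ∈ T`, and `P` is the projection orthogonal to them. -/
theorem spa_near_vertices {m n r : ℕ} (w : Fin r → EuclideanSpace ℝ (Fin m))
    (x : Fin n → EuclideanSpace ℝ (Fin m)) (H : Matrix (Fin r) (Fin n) ℝ) {e : ℝ}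
    (hw : ∀ c : EuclideanSpace ℝ (Fin r), 98 / 100 * ‖c‖ ≤ ‖∑ i, c i • w i‖)
    (hwu : ∀ i, ‖w i‖ ≤ 21 / 20) (hH : ∀ i j, 0 ≤ H i j) (hH1 : ∀ j, ∑ i, H i j ≤ 1)
    (hx : ∀ k, ‖x k - ∑ i, H i k • w i‖ ≤ e) (hvert : ∀ i, ∃ k, ‖w i - x k‖ ≤ e)
    (he0 : 0 ≤ e) (he : e ≤ 1 / 1000) (her : √r * (25 * e) ≤ 1 / 100)
    {X : Matrix (Fin m) (Fin n) ℝ} {s : ℕ} {K : Finset (Fin n)} (hK : IsSPA X s K)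
    (T : Finset (Fin r)) (hs : s + T.card = r) (f : Fin r → Fin n)
    (P : EuclideanSpace ℝ (Fin m) →ₗ[ℝ] EuclideanSpace ℝ (Fin m))
    (hX : ∀ k, WithLp.toLp 2 (fun i => X i k) = P (x k)) (hP : ∀ v, ‖P v‖ ≤ ‖v‖)
    (hspan : ∀ v, ∃ a : EuclideanSpace ℝ (Fin r),
      (∀ i ∉ T, a i = 0) ∧ P v = v - ∑ i, a i • x (f i))
    (hPT : ∀ i ∈ T, P (x (f i)) = 0) (hfT : ∀ i ∈ T, ‖w i - x (f i)‖ ≤ 25 * e) :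
    ∀ i ∉ T, ∃ k ∈ K, ‖w i - x k‖ ≤ 25 * e := by
  induction hK generalizing T f P with
  | nil X =>
    intro i hi
    have : T = Finset.univ := by
      rw [← Finset.card_eq_iff_eq_univ, Fintype.card_fin]
      omega
    exact absurd (this ▸ Finset.mem_univ i) hi
  | step X s k K hmax _ ih =>
    have hcomb : ∀ c : EuclideanSpace ℝ (Fin r), (∀ i ∈ T, c i = 0) →
        97 / 100 * ‖c‖ ≤ ‖P (∑ i, c i • w i)‖ := by
      intro c hc
      obtain ⟨a, ha, hPa⟩ := hspan (∑ i, c i • w i)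
      rw [hPa]
      exact norm_proj_comb_ge w (fun i => x (f i)) hw T (by positivity) her hfT c a hc ha
    have hTc : Tᶜ.Nonempty := by
      rw [← Finset.card_pos, Finset.card_compl, Fintype.card_fin]
      omega
    obtain ⟨i₀, hi₀, hnear⟩ : ∃ i ∉ T, ‖w i - x k‖ ≤ 25 * e := by
      refine exists_near_vertex w T hTc P hP hwu ?_ ?_ ?_ (fun i => H i k) (fun i => hH i k)
        (hH1 k) (by linarith) (x k) (hx k) ?_
      · intro i hi
        have h1 : P (w i) = P (w i - x (f i)) := by rw [map_sub, hPT i hi, sub_zero]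
        rw [h1]
        linarith [hP (w i - x (f i)), hfT i hi]
      · intro i hi
        have h1 := hcomb (EuclideanSpace.single i 1) (fun j hj => by
          simp [show j ≠ i from fun h => hi (h ▸ hj)])
        simpa [Pi.single_apply] using h1
      · intro i hi j hj hij
        have h1 := hcomb (EuclideanSpace.single i 1 - EuclideanSpace.single j 1)
          (fun l hl => by
            simp [show l ≠ i from fun h => hi (h ▸ hl), show l ≠ j from fun h => hj (h ▸ hl)])
        have h2 : ‖EuclideanSpace.single i (1 : ℝ) - EuclideanSpace.single j 1‖ ^ 2 = 2 := by
          rw [norm_sub_sq_real, EuclideanSpace.inner_single_left]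
          simp [hij]
          norm_num
        have h3 : P (∑ l, (EuclideanSpace.single i 1 - EuclideanSpace.single j 1 :
            EuclideanSpace ℝ (Fin r)) l • w l) = P (w i) - P (w j) := by
          simp [sub_smul, Finset.sum_sub_distrib]
        rw [h3] at h1
        have h4 := pow_le_pow_left₀ (by positivity) h1 2
        rw [mul_pow, h2] at h4
        linarith
      · intro i hi
        obtain ⟨j, hj⟩ := hvert i
        have h1 := hmax j
        rw [colNorm_eq_norm, colNorm_eq_norm, hX, hX] at h1
        have h2 := norm_sub_norm_le (P (w i)) (P (x j))
        rw [← map_sub] at h2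
        linarith [hP (w i - x j)]
    set u := P (x k) with hu
    have hrec := ih (insert i₀ T) (by rw [Finset.card_insert_of_notMem hi₀]; omega)
      (Function.update f i₀ k) (deflate P u) ?_ ?_ ?_ ?_ ?_
    · intro i hi
      by_cases hii : i = i₀
      · subst hii
        exact ⟨k, Finset.mem_insert_self _ _, hnear⟩
      · obtain ⟨k', hk', h⟩ := hrec i (by simp [hii, hi])
        exact ⟨k', Finset.mem_insert_of_mem hk', h⟩
    · intro j
      rw [deflate_apply, ← hX j, hu, ← hX k]
      ext i
      simp [projOut, PiLp.inner_apply, mul_comm, -inner_self_eq_norm_sq_to_K]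
    · intro v
      rw [deflate_apply]
      exact (norm_sub_inner_div_smul_le _ _).trans (hP v)
    · intro v
      obtain ⟨a, ha, hPa⟩ := hspan v
      obtain ⟨b, hb, hPb⟩ := hspan (x k)
      set q := inner ℝ u (P v) / inner ℝ u u with hq
      refine ⟨a - q • b + EuclideanSpace.single i₀ q, ?_, ?_⟩
      · intro i hi
        rw [Finset.mem_insert, not_or] at hi
        simp [ha i hi.2, hb i hi.2, hi.1]
      · have hupd : ∀ c : EuclideanSpace ℝ (Fin r), (∀ i ∉ T, c i = 0) →
            ∑ i, c i • x (Function.update f i₀ k i) = ∑ i, c i • x (f i) := by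
          intro c hc
          refine Finset.sum_congr rfl fun i _ => ?_
          by_cases hii : i = i₀
          · subst hii; simp [hc i hi₀]
          · rw [Function.update_of_ne hii]
        have h1 : ∑ i, (a - q • b + EuclideanSpace.single i₀ q) i •
            x (Function.update f i₀ k i) =
            ∑ i, a i • x (f i) - q • ∑ i, b i • x (f i) + q • x k := by
          rw [← hupd a ha, ← hupd b hb, Finset.smul_sum]
          simp [add_smul, sub_smul, Finset.sum_add_distrib, Finset.sum_sub_distrib, mul_smul]
        rw [h1, deflate_apply, ← hq, hPa, hu, hPb]
        module
    · intro i hi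
      rw [deflate_apply]
      by_cases hii : i = i₀
      · subst hii
        rw [Function.update_self, ← hu]
        rcases eq_or_ne u 0 with h0 | h0
        · simp [h0]
        · rw [div_self (inner_self_ne_zero.2 h0)]
          simp
      · rw [Function.update_of_ne hii, hPT i (by simpa [hii] using hi)]
        simp
    · intro i hi
      by_cases hii : i = i₀
      · subst hii
        rwa [Function.update_self]
      · rw [Function.update_of_ne hii]
        exact hfT i (by simpa [hii] using hi)

theorem toLp_col_eq {m n : ℕ} (X : Matrix (Fin m) (Fin n) ℝ) (j : Fin n) :
    WithLp.toLp 2 (fun i => X i j) = X.toEuclideanLin (EuclideanSpace.single j 1) := by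
  ext i
  simp [Matrix.toLpLin_apply]

theorem toEuclideanLin_eq_sum_col {m n : ℕ} (X : Matrix (Fin m) (Fin n) ℝ)
    (v : EuclideanSpace ℝ (Fin n)) :
    X.toEuclideanLin v = ∑ j, v j • X.toEuclideanLin (EuclideanSpace.single j 1) := by
  simp_rw [← toLp_col_eq]
  ext i
  simp [Matrix.toLpLin_apply, Matrix.mulVec, dotProduct, mul_comm]

theorem norm_le_one_of_sum_le_one {r : ℕ} (h : Fin r → ℝ) (hh : ∀ i, 0 ≤ h i)
    (hsum : ∑ i, h i ≤ 1) : ‖(WithLp.toLp 2 h : EuclideanSpace ℝ (Fin r))‖ ≤ 1 := by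
  rw [EuclideanSpace.norm_eq, Real.sqrt_le_one]
  refine le_trans (Finset.sum_le_sum fun i _ => ?_) hsum
  have hi : h i ≤ 1 := (Finset.single_le_sum (fun i _ => hh i) (Finset.mem_univ i)).trans hsum
  rw [PiLp.toLp_apply, Real.norm_eq_abs, sq_abs]
  nlinarith [hh i]

theorem dotProduct_gram_mulVec {r : ℕ} (Q : Matrix (Fin r) (Fin r) ℝ) (v : Fin r → ℝ) :
    v ⬝ᵥ (Qᵀ * Q).mulVec v = ‖Q.toEuclideanLin (WithLp.toLp 2 v)‖ ^ 2 := by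
  rw [← real_inner_self_eq_norm_sq, ← inner_gram_apply]
  simp [Matrix.toLpLin_apply, PiLp.inner_apply, dotProduct, mul_comm]

/-- An optimal ellipsoid for points `W * (h + p)` with `h` in the solid simplex and `‖p‖ ≤ d` has
determinant at least that of the ball of radius `1 / (1 - d)` in the coordinates given by `W`. -/
theorem le_det_of_sdpOptimal {r n : ℕ} {W A : Matrix (Fin r) (Fin r) ℝ}
    {Mt : Matrix (Fin r) (Fin n) ℝ} (hA : SDPOptimal Mt A) {d : ℝ} (hd0 : 0 ≤ d) (hd1 : d ≤ 1)
    (hMt : ∀ k, ‖(W⁻¹ * Mt).toEuclideanLin (EuclideanSpace.single k 1)‖ ≤ 1 + d) :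
    (1 - d) ^ (2 * r) * (W⁻¹).det ^ 2 ≤ A.det := by
  set V := (1 - d) • W⁻¹ with hV
  have hdet : (Vᵀ * V).det = (1 - d) ^ (2 * r) * (W⁻¹).det ^ 2 := by
    rw [Matrix.det_mul, Matrix.det_transpose, hV, Matrix.det_smul, Fintype.card_fin]
    ring
  rw [← hdet]
  refine hA.2 _ ⟨by simpa using Matrix.posSemidef_conjTranspose_mul_self V, fun k => ?_⟩
  rw [dotProduct_gram_mulVec, toLp_col_eq, hV, map_smul, LinearMap.smul_apply, norm_smul,
    ← toEuclideanLin_mul_apply, Real.norm_of_nonneg (by linarith)]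
  refine pow_le_one₀ (mul_nonneg (by linarith) (norm_nonneg _)) ?_
  calc (1 - d) * ‖(W⁻¹ * Mt).toEuclideanLin (EuclideanSpace.single k 1)‖
      ≤ (1 - d) * (1 + d) := mul_le_mul_of_nonneg_left (hMt k) (by linarith)
    _ ≤ 1 := by nlinarith

theorem near_isometry_perturb {r : ℕ} {V P : Matrix (Fin r) (Fin r) ℝ} (hPu : IsUnit P.det)
    (hP : ∀ v : EuclideanSpace ℝ (Fin r), ‖P.toEuclideanLin v - v‖ ≤ 1 / 1000 * ‖v‖)
    (hVP : ∀ v : EuclideanSpace ℝ (Fin r), 99 / 100 * ‖v‖ ≤ ‖(V * P).toEuclideanLin v‖ ∧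
      ‖(V * P).toEuclideanLin v‖ ≤ 101 / 100 * ‖v‖) (v : EuclideanSpace ℝ (Fin r)) :
    98 / 100 * ‖v‖ ≤ ‖V.toEuclideanLin v‖ ∧ ‖V.toEuclideanLin v‖ ≤ 102 / 100 * ‖v‖ := by
  obtain ⟨z, rfl⟩ : ∃ z, P.toEuclideanLin z = v := by
    refine ⟨(P⁻¹).toEuclideanLin v, ?_⟩
    rw [← toEuclideanLin_mul_apply, Matrix.mul_nonsing_inv _ hPu]
    simp
  rw [← toEuclideanLin_mul_apply]
  have h1 := hP z
  have h2 := norm_sub_norm_le (P.toEuclideanLin z) z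
  have h3 := norm_sub_norm_le z (P.toEuclideanLin z)
  rw [norm_sub_rev] at h3
  have h4 := hVP z
  have h5 := norm_nonneg z
  constructor <;> linarith [h4.1, h4.2]

theorem preconditioner_near_isometry {r n : ℕ} (hr : 0 < r) {W A Q : Matrix (Fin r) (Fin r) ℝ}
    {H N Mt : Matrix (Fin r) (Fin n) ℝ} {ε d : ℝ} (hM : NearSepSquare r n W H N Mt ε)
    (hA : SDPOptimal Mt A) (hQ : Qᵀ * Q = A)
    (hd : √r * d ≤ 1 / 100000 / r)
    (hN : ∀ k, ‖(W⁻¹ * N).toEuclideanLin (EuclideanSpace.single k 1)‖ ≤ d)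
    (v : EuclideanSpace ℝ (Fin r)) :
    98 / 100 * ‖v‖ ≤ ‖(Q * W).toEuclideanLin v‖ ∧
      ‖(Q * W).toEuclideanLin v‖ ≤ 102 / 100 * ‖v‖ := by
  obtain ⟨hW, hMt, hH, hH1, ⟨hrn, hid⟩, -, -⟩ := hM
  have hd0 : 0 ≤ d := (norm_nonneg _).trans (hN (Fin.castLE hrn ⟨0, hr⟩))
  have hr1 : (1 : ℝ) ≤ r := by exact_mod_cast hr
  have hdr : d ≤ 1 / 100000 / r := by
    have : (1 : ℝ) ≤ √r := Real.one_le_sqrt.2 hr1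
    nlinarith
  have hcr : (1 / 100000 / r : ℝ) ≤ 1 / 100000 := div_le_self (by norm_num) hr1
  set M₀ := Mt.submatrix id (Fin.castLE hrn) with hM₀
  set P := W⁻¹ * M₀ with hP
  have hQP : Q * W * P = Q * M₀ := by
    rw [hP, Matrix.mul_assoc, Matrix.mul_nonsing_inv_cancel_left _ _ hW]
  have hWMt : W⁻¹ * Mt = H + W⁻¹ * N := by
    rw [hMt, Matrix.mul_add, Matrix.nonsing_inv_mul_cancel_left _ _ hW]
  have hPsub : P = 1 + (W⁻¹ * N).submatrix id (Fin.castLE hrn) := by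
    have : P = (W⁻¹ * Mt).submatrix id (Fin.castLE hrn) := by
      rw [hP, hM₀]; rfl
    rw [this, hWMt]
    ext i j
    simp [Matrix.one_apply, hid]
  have hPv : ∀ v : EuclideanSpace ℝ (Fin r),
      ‖P.toEuclideanLin v - v‖ ≤ 1 / 100000 / r * ‖v‖ := by
    intro v
    have h1 : P.toEuclideanLin v - v =
        ((W⁻¹ * N).submatrix id (Fin.castLE hrn)).toEuclideanLin v := by
      rw [hPsub, map_add, LinearMap.add_apply]
      simp
    rw [h1, toEuclideanLin_eq_sum_col]
    refine (norm_sum_smul_le_sqrt_mul v _ hd0 fun j _ => ?_).trans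
      (mul_le_mul_of_nonneg_right hd (norm_nonneg _))
    have h2 := hN (Fin.castLE hrn j)
    rw [← toLp_col_eq] at h2 ⊢
    exact h2
  set a : ℝ := 1 - 1 / 100000 / r with ha
  have ha0 : 0 ≤ a := by linarith
  have hdetP : a ^ (2 * r) ≤ P.det ^ 2 := by
    refine pow_le_det_sq P ha0 fun v => ?_
    have h1 := norm_sub_norm_le v (P.toEuclideanLin v)
    rw [norm_sub_rev] at h1
    rw [ha, sub_mul, one_mul]
    linarith [hPv v]
  have hPu : IsUnit P.det := by
    rw [isUnit_iff_ne_zero]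
    intro h0
    rw [h0] at hdetP
    have : 0 < a ^ (2 * r) := pow_pos (by linarith) _
    norm_num at hdetP
    linarith
  refine near_isometry_perturb hPu (fun v => (hPv v).trans ?_) (fun v => ?_) v
  · exact mul_le_mul_of_nonneg_right (by linarith) (norm_nonneg _)
  refine near_isometry_of_det _ (fun j => ?_) ?_ v
  · rw [hQP, colNorm_eq_norm, toLp_col_eq, toEuclideanLin_mul_apply, ← toLp_col_eq M₀]
    have h1 := hA.1.2 (Fin.castLE hrn j)
    rw [← hQ, dotProduct_gram_mulVec] at h1
    exact (sq_le_one_iff₀ (norm_nonneg _)).1 h1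
  · have hdetA := le_det_of_sdpOptimal (W := W) hA hd0 (by linarith) fun k => by
      rw [hWMt, map_add, LinearMap.add_apply]
      refine (norm_add_le _ _).trans (add_le_add ?_ (hN k))
      rw [← toLp_col_eq]
      exact norm_le_one_of_sum_le_one _ (fun i => hH i k) (hH1 k)
    have hWinv : (W⁻¹).det * W.det = 1 := by
      rw [← Matrix.det_mul, Matrix.nonsing_inv_mul _ hW, Matrix.det_one]
    have hAQ : A.det = Q.det ^ 2 := by
      rw [← hQ, Matrix.det_mul, Matrix.det_transpose, sq]
    have hdetQW : a ^ (2 * r) ≤ (Q.det * W.det) ^ 2 := by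
      calc a ^ (2 * r) ≤ (1 - d) ^ (2 * r) := pow_le_pow_left₀ ha0 (by linarith) _
        _ = (1 - d) ^ (2 * r) * (W⁻¹).det ^ 2 * W.det ^ 2 := by
          rw [mul_assoc, ← mul_pow, hWinv]; ring
        _ ≤ A.det * W.det ^ 2 := mul_le_mul_of_nonneg_right hdetA (sq_nonneg _)
        _ = _ := by rw [hAQ]; ring
    have hbern : 1 - 1 / 20000 ≤ a ^ (4 * r) := by
      have h1 := one_add_mul_le_pow (a := -(1 / 100000 / r : ℝ)) (by linarith) (4 * r)
      rw [← sub_eq_add_neg, ← ha] at h1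
      refine le_trans ?_ h1
      push_cast
      have : (r : ℝ) ≠ 0 := by positivity
      field_simp
      norm_num
    calc 1 - 1 / 20000 ≤ a ^ (4 * r) := hbern
      _ = a ^ (2 * r) * a ^ (2 * r) := by rw [← pow_add]; congr 1; omega
      _ ≤ (Q.det * W.det) ^ 2 * P.det ^ 2 :=
        mul_le_mul hdetQW hdetP (by positivity) (by positivity)
      _ = _ := by rw [Matrix.det_mul (Q * W), Matrix.det_mul Q W]; ring

/-- Main theorem: robustness of preconditioned SPA, where the preconditioner `Q` satisfies
`QᵀQ = A*` with `A*` an optimal solution of the minimum-volume-ellipsoid SDP. -/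
theorem preconditioned_spa_main :
    ∃ c₁ > (0 : ℝ), ∃ c₂ > (0 : ℝ),
      ∀ (n r : ℕ) (W : Matrix (Fin r) (Fin r) ℝ) (H : Matrix (Fin r) (Fin n) ℝ)
        (N Mt : Matrix (Fin r) (Fin n) ℝ) (ε : ℝ) (A Q : Matrix (Fin r) (Fin r) ℝ)
        (K : Finset (Fin n)),
        NearSepSquare r n W H N Mt ε →
        ε ≤ c₁ * sigmaMin W / (r * Real.sqrt r) →
        SDPOptimal Mt A →
        Qᵀ * Q = A →
        IsSPA (Q * Mt) r K →
        ∀ j : Fin r, ∃ k ∈ K,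
          colNorm (fun i => W i j - Mt i k) ≤ c₂ * ε * kappa W := by
  refine ⟨1 / 100000, by norm_num, 30, by norm_num, ?_⟩
  intro n r W H N Mt ε A Q K hM hε hA hQ hK j
  have hr : 0 < r := j.pos
  have hr1 : (1 : ℝ) ≤ r := by exact_mod_cast hr
  have hr0 : (0 : ℝ) < r := by linarith
  have hM' := hM
  obtain ⟨hW, hMt, hH, hH1, ⟨hrn, hid⟩, hε0, hN⟩ := hM'
  have hσ := sigmaMin_pos hr W hW
  set d := ε / sigmaMin W with hd
  have hd0 : 0 ≤ d := by positivity
  have hsd : √r * d ≤ 1 / 100000 / r := by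
    rw [hd, ← mul_div_assoc, div_le_iff₀ hσ]
    calc √r * ε ≤ √r * (1 / 100000 * sigmaMin W / (r * √r)) := by gcongr
      _ = _ := by field_simp
  have hcr : (1 / 100000 / r : ℝ) ≤ 1 / 100000 := div_le_self (by norm_num) hr1
  have hWinv : ∀ v, W.toEuclideanLin ((W⁻¹).toEuclideanLin v) = v := fun v => by
    rw [← toEuclideanLin_mul_apply, Matrix.mul_nonsing_inv _ hW]
    simp
  have hN' : ∀ k, ‖(W⁻¹ * N).toEuclideanLin (EuclideanSpace.single k 1)‖ ≤ d := fun k => by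
    have h1 := sigmaMin_mul_norm_le W ((W⁻¹ * N).toEuclideanLin (EuclideanSpace.single k 1))
    rw [toEuclideanLin_mul_apply, hWinv, ← toLp_col_eq N] at h1
    rw [toEuclideanLin_mul_apply, ← toLp_col_eq N, hd, le_div_iff₀' hσ]
    exact h1.trans ((colNorm_eq_norm _).ge.trans (hN k))
  have hV := preconditioner_near_isometry hr hM hA hQ hsd hN'
  have hQMt : Q * Mt = Q * W * H + Q * W * (W⁻¹ * N) := by
    rw [hMt, Matrix.mul_add, Matrix.mul_assoc, Matrix.mul_assoc,
      Matrix.mul_nonsing_inv_cancel_left _ _ hW]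
  set w : Fin r → EuclideanSpace ℝ (Fin r) :=
    fun i => (Q * W).toEuclideanLin (EuclideanSpace.single i 1) with hw
  set x : Fin n → EuclideanSpace ℝ (Fin r) :=
    fun k => (Q * Mt).toEuclideanLin (EuclideanSpace.single k 1) with hx
  have hxw : ∀ k, ‖x k - ∑ i, H i k • w i‖ ≤ 102 / 100 * d := fun k => by
    have h1 : x k - ∑ i, H i k • w i = (Q * W).toEuclideanLin
        ((W⁻¹ * N).toEuclideanLin (EuclideanSpace.single k 1)) := by
      simp only [hx, hw]
      rw [← toEuclideanLin_mul_apply, hQMt, map_add, LinearMap.add_apply,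
        toEuclideanLin_mul_apply (Q * W) H, ← toLp_col_eq H, toEuclideanLin_eq_sum_col (Q * W)]
      simp
    rw [h1]
    exact (hV _).2.trans (mul_le_mul_of_nonneg_left (hN' k) (by norm_num))
  have hdle : d ≤ 1 / 100000 := by
    have : (1 : ℝ) ≤ √r := Real.one_le_sqrt.2 hr1
    nlinarith
  obtain ⟨k, hk, hnear⟩ := spa_near_vertices w x H (e := 102 / 100 * d)
    (fun c => by rw [hw, ← toEuclideanLin_eq_sum_col]; exact (hV c).1)
    (fun i => by
      refine (hV _).2.trans ?_
      rw [PiLp.norm_single]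
      norm_num)
    hH hH1 hxw
    (fun i => ⟨Fin.castLE hrn i, by
      have h1 := hxw (Fin.castLE hrn i)
      simp only [hid, ite_smul, one_smul, zero_smul, Finset.sum_ite_eq', Finset.mem_univ,
        if_true] at h1
      rwa [norm_sub_rev]⟩)
    (by positivity) (by linarith) (by linarith) hK ∅ (by simp) (Fin.castLE hrn) LinearMap.id
    (fun k => toLp_col_eq (Q * Mt) k) (fun v => le_rfl)
    (fun v => ⟨0, by simp⟩) (by simp) (by simp) j (by simp)
  refine ⟨k, hk, ?_⟩
  set y := (W⁻¹).toEuclideanLin (WithLp.toLp 2 (fun i => W i j - Mt i k)) with hy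
  have hWy : W.toEuclideanLin y = WithLp.toLp 2 (fun i => W i j - Mt i k) := hWinv _
  have hVy : (Q * W).toEuclideanLin y = w j - x k := by
    have h1 : WithLp.toLp 2 (fun i => W i j - Mt i k) =
        WithLp.toLp 2 (fun i => W i j) - WithLp.toLp 2 (fun i => Mt i k) := rfl
    rw [toEuclideanLin_mul_apply, hWy, h1, map_sub, toLp_col_eq, toLp_col_eq,
      ← toEuclideanLin_mul_apply, ← toEuclideanLin_mul_apply]
  have hyd : ‖y‖ ≤ 30 * d := by
    have h1 := (hV y).1
    rw [hVy] at h1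
    linarith
  have hσM : 0 ≤ sigmaMax W := by
    have h1 := norm_le_sigmaMax_mul W (EuclideanSpace.single j 1)
    rw [PiLp.norm_single, norm_one, mul_one] at h1
    exact (norm_nonneg _).trans h1
  rw [colNorm_eq_norm, ← hWy]
  calc ‖W.toEuclideanLin y‖ ≤ sigmaMax W * ‖y‖ := norm_le_sigmaMax_mul W y
    _ ≤ sigmaMax W * (30 * d) := mul_le_mul_of_nonneg_left hyd hσM
    _ = 30 * ε * kappa W := by rw [hd, kappa]; ring
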